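/- Existence of an inversion-free optimal preemptive schedule: let all processing times equal 1, suppose at least one feasible unit schedule for m machines exists, and let (L_j) be a closed collection of minimal chains. Then there exists a feasible unit schedule whose makespan equals the minimum makespan over all feasible unit schedules and in which C i < C j for every job j and every job i ≠ j occurring in L_j. -/

import Mathlib

def IsChainTo {n : ℕ} (P : Fin n → Finset (Fin n)) (k : Fin n) (L : List (Fin n)) : Prop :=
  L ≠ [] ∧ L.getLast? = some k ∧
    (∀ h, L.head? = some h → P h = ∅) ∧
    L.Chain' (fun a b => a ∈ P b)

/-- Value of a chain: `t 1 = r j₁ + p j₁`, `t (q+1) = max (r j_{q+1}) (t q) + p j_{q+1}`. -/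
def chainValue {n : ℕ} (r p : Fin n → ℕ) : List (Fin n) → ℕ
  | [] => 0
  | j :: rest => rest.foldl (fun t j' => max (r j') t + p j') (r j + p j)

/-- Minimal chain length of job `k`: minimum value over all chains to `k`. -/
noncomputable def mc {n : ℕ} (P : Fin n → Finset (Fin n)) (r p : Fin n → ℕ) (k : Fin n) : ℕ :=
  sInf {v | ∃ L, IsChainTo P k L ∧ chainValue r p L = v}

/-- Feasible unit schedule w.r.t. predecessor sets `Q`: each job `j` occupies
slot `[C j - 1, C j)`; at most `m` jobs per slot; release dates respected;
each job with predecessors is preceded by one of them. -/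
def FeasibleUnit {n : ℕ} (m : ℕ) (Q : Fin n → Finset (Fin n)) (r C : Fin n → ℕ) : Prop :=
  (∀ j, 1 ≤ C j) ∧
    (∀ t : ℕ, (Finset.univ.filter fun j : Fin n => C j = t).card ≤ m) ∧
    (∀ j, r j + 1 ≤ C j) ∧
    ∀ j, Q j ≠ ∅ → ∃ i ∈ Q j, C i < C j

def makespanU {n : ℕ} (C : Fin n → ℕ) : ℕ := Finset.univ.sup C

/-- A closed collection of minimal chains (for unit processing times):
`L j` is a chain to `j` of value `mc j`, and if `i` occurs in `L j` then
`L i` is a prefix of `L j` (necessarily the prefix ending at `i`). -/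
def ClosedCollection {n : ℕ} (P : Fin n → Finset (Fin n)) (r : Fin n → ℕ)
    (L : Fin n → List (Fin n)) : Prop :=
  ∀ j, IsChainTo P j (L j) ∧ chainValue r (fun _ => 1) (L j) = mc P r (fun _ => 1) j ∧
    ∀ i ∈ L j, L i <+: L j

/-- Number of inverted pairs `(i, j)`: `i` occurs in `L j`, `i ≠ j`, and `C i ≥ C j`. -/
def inversions {n : ℕ} (L : Fin n → List (Fin n)) (C : Fin n → ℕ) : ℕ :=
  (Finset.univ.filter fun q : Fin n × Fin n =>
    q.1 ∈ L q.2 ∧ q.1 ≠ q.2 ∧ C q.2 ≤ C q.1).card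

/-- Relaxed feasibility: release dates `d`, deadline `T`, capacity `m`. -/
def RelaxFeas {n : ℕ} (m T : ℕ) (d C : Fin n → ℕ) : Prop :=
  (∀ j, d j ≤ C j) ∧ (∀ j, C j ≤ T) ∧
    ∀ t : ℕ, (Finset.univ.filter fun j : Fin n => C j = t).card ≤ m

lemma card_swap {n : ℕ} (C : Fin n → ℕ) (σ : Equiv.Perm (Fin n)) (t : ℕ) :
    (Finset.univ.filter fun j : Fin n => C (σ j) = t).card =
      (Finset.univ.filter fun j : Fin n => C j = t).card := by
  apply Finset.card_bij (fun a _ => σ a)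
  · intro a ha; simpa using ha
  · intro a _ b _ h; exact σ.injective h
  · intro b hb; exact ⟨σ.symm b, by simpa using hb, by simp⟩

/-- First phase: no strict inversions. -/
lemma exists_weak {n m T : ℕ} (d : Fin n → ℕ) (A : Fin n → Fin n → Prop)
    (hd : ∀ i j, A i j → d i < d j) (hC : ∃ C, RelaxFeas m T d C) :
    ∃ C, RelaxFeas m T d C ∧ ∀ i j, A i j → C i ≤ C j := by
  classical
  have key : ∀ N : ℕ, ∀ C, RelaxFeas m T d C → (∑ x, d x * T) - (∑ x, d x * C x) ≤ N →
      ∃ C, RelaxFeas m T d C ∧ ∀ i j, A i j → C i ≤ C j := by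
    intro N
    induction N with
    | zero =>
      intro C hC hN
      refine ⟨C, hC, fun i j hij => ?_⟩
      have h1 : ∀ x ∈ Finset.univ, d x * C x ≤ d x * T :=
        fun x _ => Nat.mul_le_mul_left _ (hC.2.1 x)
      have h2 : ∑ x, d x * C x = ∑ x, d x * T :=
        le_antisymm (Finset.sum_le_sum h1) (by omega)
      have h3 := (Finset.sum_eq_sum_iff_of_le h1).1 h2 j (Finset.mem_univ _)
      have h4 : C j = T := Nat.eq_of_mul_eq_mul_left (by have := hd i j hij; omega) h3
      rw [h4]; exact hC.2.1 i
    | succ N ih =>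
      intro C hC hN
      by_cases h : ∀ i j, A i j → C i ≤ C j
      · exact ⟨C, hC, h⟩
      push Not at h
      obtain ⟨i, j, hij, hlt⟩ := h
      have hdij := hd i j hij
      have hne : i ≠ j := by rintro rfl; omega
      have hi := hC.1 i
      have hj := hC.1 j
      have hF : RelaxFeas m T d (fun x => C (Equiv.swap i j x)) := by
        refine ⟨fun x => ?_, fun x => hC.2.1 _, fun t => ?_⟩
        · simp only [Equiv.swap_apply_def]
          split_ifs with h1 h2
          · subst h1; omega
          · subst h2; omega
          · exact hC.1 x
        · rw [card_swap C (Equiv.swap i j) t]; exact hC.2.2 t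
      apply ih _ hF
      have hsplit : ∀ f : Fin n → ℕ,
          ∑ x, f x = f i + (f j + ∑ x ∈ (Finset.univ.erase i).erase j, f x) := by
        intro f
        rw [Finset.add_sum_erase _ _ (by simp [hne.symm]), Finset.add_sum_erase _ _ (by simp)]
      have hlt' : ∑ x, d x * C x < ∑ x, d x * C (Equiv.swap i j x) := by
        rw [hsplit, hsplit (fun x => d x * C (Equiv.swap i j x))]
        have hrest : ∑ x ∈ (Finset.univ.erase i).erase j, d x * C (Equiv.swap i j x)
            = ∑ x ∈ (Finset.univ.erase i).erase j, d x * C x := by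
          apply Finset.sum_congr rfl
          intro x hx
          simp at hx
          rw [Equiv.swap_apply_of_ne_of_ne hx.2 hx.1]
        rw [hrest]
        simp only [Equiv.swap_apply_left, Equiv.swap_apply_right]
        obtain ⟨a, ha⟩ := Nat.exists_eq_add_of_lt hdij
        obtain ⟨b, hb⟩ := Nat.exists_eq_add_of_lt hlt
        rw [ha, hb]
        nlinarith [Nat.zero_le (a*b)]
      have hle : ∑ x, d x * C (Equiv.swap i j x) ≤ ∑ x, d x * T :=
        Finset.sum_le_sum fun x _ => Nat.mul_le_mul_left _ (hC.2.1 _)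
      omega
  obtain ⟨C, hC⟩ := hC
  exact key _ C hC le_rfl

/-- `x` shares its slot with an ancestor. -/
def Tied {n : ℕ} (A : Fin n → Fin n → Prop) (C : Fin n → ℕ) (x : Fin n) : Prop :=
  ∃ y, A y x ∧ C y = C x

open Classical in
/-- Potential: total completion time of tied jobs. -/
noncomputable def pot {n : ℕ} (A : Fin n → Fin n → Prop) (C : Fin n → ℕ) : ℕ :=
  ∑ x, if Tied A C x then C x else 0

open Classical in
/-- One improvement step, for a given set `K` of jobs to postpone. -/
lemma step {n m T : ℕ} (d : Fin n → ℕ) (A : Fin n → Fin n → Prop)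
    (hd : ∀ i j, A i j → d i < d j)
    (hcomp : ∀ i i' j, A i j → A i' j → A i i' ∨ i = i' ∨ A i' i)
    (C : Fin n → ℕ) (hC : RelaxFeas m T d C) (hw : ∀ i j, A i j → C i ≤ C j)
    (i j : Fin n) (t : ℕ) (hij : A i j) (hi : C i = t + 1) (hj : C j = t + 1)
    (hmin : ∀ x, Tied A C x → t + 1 ≤ C x)
    (hmin' : ∀ x, Tied A C x → C x = t + 1 → d j ≤ d x)
    (K : Fin n → Prop) (hK : ∀ k, K k → C k = t ∧ ∀ x, A k x → C x ≠ t + 1)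
    (C' : Fin n → ℕ) (hC'i : C' i = t) (hC'K : ∀ x, K x → C' x = t + 1)
    (hC'o : ∀ x, x ≠ i → ¬ K x → C' x = C x)
    (hcap : ∀ s : ℕ, (Finset.univ.filter fun j : Fin n => C' j = s).card ≤ m) :
    RelaxFeas m T d C' ∧ (∀ i j, A i j → C' i ≤ C' j) ∧ pot A C' < pot A C := by
  have hdij := hd i j hij
  have hne : i ≠ j := by rintro rfl; omega
  have hKi : ∀ k, K k → k ≠ i := by
    rintro k hk rfl; have := (hK k hk).1; omega
  have hnti : ¬ Tied A C i := fun h => by have := hmin' i h hi; omega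
  have hanc : ∀ x, A x i → C x ≤ t := by
    intro x hx
    have h1 := hw _ _ hx
    by_contra h2
    exact hnti ⟨x, hx, by omega⟩
  have hcase : ∀ x, x = i ∨ (x ≠ i ∧ K x) ∨ (x ≠ i ∧ ¬ K x) := by
    intro x; tauto
  have hdesc : ∀ k, K k → ∀ y, A k y → t + 1 < C y := by
    intro k hk y hy
    have h1 := hw _ _ hy
    have h2 := (hK k hk).1
    have h3 := (hK k hk).2 y hy
    by_contra h4
    have := hmin y ⟨k, hy, by omega⟩
    omega
  have hT1 := hC.2.1 i
  refine ⟨⟨?_, ?_, hcap⟩, ?_, ?_⟩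
  · intro x
    have := hC.1 x
    rcases hcase x with rfl | ⟨_, h⟩ | ⟨h1, h2⟩
    · have := hC.1 j; omega
    · have := (hK x h).1; have := hC'K x h; omega
    · rw [hC'o x h1 h2]; omega
  · intro x
    have := hC.2.1 x
    rcases hcase x with rfl | ⟨_, h⟩ | ⟨h1, h2⟩
    · omega
    · have := (hK x h).1; have := hC'K x h; omega
    · rw [hC'o x h1 h2]; omega
  · intro x y hxy
    have h0 := hw x y hxy
    rcases hcase x with rfl | ⟨hx1, hx2⟩ | ⟨hx1, hx2⟩ <;>
    rcases hcase y with rfl | ⟨hy1, hy2⟩ | ⟨hy1, hy2⟩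
    · omega
    · have := (hK y hy2).1; omega
    · have := hC'o y hy1 hy2; omega
    · have := hdesc x hx2 _ hxy; omega
    · rw [hC'K x hx2, hC'K y hy2]
    · have := hdesc x hx2 _ hxy
      rw [hC'K x hx2, hC'o y hy1 hy2]; omega
    · have := hanc x hxy
      rw [hC'o x hx1 hx2]; omega
    · have := (hK y hy2).1
      rw [hC'o x hx1 hx2, hC'K y hy2]; omega
    · rw [hC'o x hx1 hx2, hC'o y hy1 hy2]; omega
  · have hsplit : ∀ f : Fin n → ℕ,
        ∑ x, f x = f i + (f j + ∑ x ∈ (Finset.univ.erase i).erase j, f x) := by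
      intro f
      rw [Finset.add_sum_erase _ _ (by simp [hne.symm]), Finset.add_sum_erase _ _ (by simp)]
    unfold pot
    rw [hsplit, hsplit (fun x => if Tied A C x then C x else 0)]
    have htj : Tied A C j := ⟨i, hij, by omega⟩
    have hjK : ¬ K j := fun h => by have := (hK j h).1; omega
    have htj' : ¬ Tied A C' j := by
      rintro ⟨y, hy, hyC⟩
      rw [hC'o j hne.symm hjK, hj] at hyC
      rcases hcase y with rfl | ⟨hy1, hy2⟩ | ⟨hy1, hy2⟩
      · omega
      · have := hdesc y hy2 _ hy; omega
      · rw [hC'o y hy1 hy2] at hyC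
        rcases hcomp i y j hij hy with h | h | h
        · have := hmin' y ⟨i, h, by omega⟩ hyC
          have := hd _ _ hy
          omega
        · exact hy1 h.symm
        · exact hnti ⟨y, h, by omega⟩
    have hrest : ∑ x ∈ (Finset.univ.erase i).erase j, (if Tied A C' x then C' x else 0)
        ≤ ∑ x ∈ (Finset.univ.erase i).erase j, (if Tied A C x then C x else 0) := by
      apply Finset.sum_le_sum
      intro x hx
      simp at hx
      obtain ⟨-, hxi⟩ := hx
      by_cases h : Tied A C' x
      swap
      · simp [h]
      obtain ⟨y, hy, hyC⟩ := h
      have h0 := hw _ _ hy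
      by_cases hxK : K x
      · exfalso
        rw [hC'K x hxK] at hyC
        have hx1 := (hK x hxK).1
        rcases hcase y with rfl | ⟨hy1, hy2⟩ | ⟨hy1, hy2⟩
        · omega
        · have := hdesc y hy2 _ hy; omega
        · rw [hC'o y hy1 hy2] at hyC; omega
      · have hx' := hC'o x hxi hxK
        have : Tied A C x := by
          rw [hx'] at hyC
          rcases hcase y with rfl | ⟨hy1, hy2⟩ | ⟨hy1, hy2⟩
          · omega
          · have := hdesc y hy2 _ hy
            have := hC'K y hy2
            omega
          · rw [hC'o y hy1 hy2] at hyC; exact ⟨y, hy, hyC⟩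
        rw [if_pos this, hx']; split_ifs <;> omega
    have h1 : (if Tied A C' i then C' i else 0) ≤ t := by split_ifs <;> omega
    rw [if_neg htj', if_pos htj, if_neg hnti]
    omega

lemma exists_strict {n m T : ℕ} (d : Fin n → ℕ) (A : Fin n → Fin n → Prop)
    (hd0 : ∀ j, 1 ≤ d j)
    (hd : ∀ i j, A i j → d i < d j)
    (htrans : ∀ i j k, A i j → A j k → A i k)
    (hcomp : ∀ i i' j, A i j → A i' j → A i i' ∨ i = i' ∨ A i' i)
    (hC : ∃ C, RelaxFeas m T d C) :
    ∃ C, RelaxFeas m T d C ∧ ∀ i j, A i j → C i < C j := by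
  classical
  have key : ∀ N : ℕ, ∀ C, RelaxFeas m T d C → (∀ i j, A i j → C i ≤ C j) → pot A C = N →
      ∃ C, RelaxFeas m T d C ∧ ∀ i j, A i j → C i < C j := by
    intro N
    induction N using Nat.strong_induction_on with
    | _ N ih =>
    intro C hC hw hN
    by_cases hs : ∀ i j, A i j → C i < C j
    · exact ⟨C, hC, hs⟩
    push Not at hs
    obtain ⟨i0, j0, hij0, hle0⟩ := hs
    have hne : (Finset.univ.filter fun x => Tied A C x).Nonempty :=
      ⟨j0, by simpa using ⟨i0, hij0, le_antisymm (hw _ _ hij0) hle0⟩⟩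
    obtain ⟨j1, hj1, hj1min⟩ := Finset.exists_min_image _ C hne
    have hne2 : (Finset.univ.filter fun x => Tied A C x ∧ C x = C j1).Nonempty :=
      ⟨j1, by simpa using hj1⟩
    obtain ⟨j, hj, hjmin⟩ := Finset.exists_min_image _ d hne2
    simp only [Finset.mem_filter, Finset.mem_univ, true_and] at hj1 hj1min hj hjmin
    obtain ⟨⟨i, hij, hCij⟩, hCj⟩ := hj
    have hdi := hd0 i
    have hdij := hd i j hij
    have hdj := hC.1 j
    obtain ⟨t, ht⟩ : ∃ t, C j = t + 1 := ⟨C j - 1, by omega⟩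
    have hmin : ∀ x, Tied A C x → t + 1 ≤ C x := fun x hx => by
      have := hj1min x hx; omega
    have hmin' : ∀ x, Tied A C x → C x = t + 1 → d j ≤ d x := fun x hx hxt =>
      hjmin x ⟨hx, by omega⟩
    by_cases hcap : (Finset.univ.filter fun x => C x = t).card < m
    · -- move `i` one slot earlier
      obtain ⟨h1, h2, h3⟩ := step d A hd hcomp C hC hw i j t hij (by omega) ht hmin hmin'
        (fun _ => False) (by simp) (Function.update C i t) (by simp) (by simp)
        (fun x hx _ => by simp [hx]) (by
          intro s
          by_cases hst : s = t
          · subst hst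
            refine le_trans (Finset.card_le_card (t := insert i
              (Finset.univ.filter fun x => C x = s)) ?_)
              (le_trans (Finset.card_insert_le _ _) hcap)
            intro x hx
            by_cases hxi : x = i
            · simp [hxi]
            · simpa [hxi] using hx
          · refine le_trans (Finset.card_le_card ?_) (hC.2.2 s)
            intro x hx
            by_cases hxi : x = i
            · subst hxi
              simp at hx
              omega
            · simpa [hxi] using hx)
      exact ih _ (by omega) _ h1 h2 rfl
    · -- swap with a suitable `k`
      obtain ⟨k, hk, hkd⟩ : ∃ k, C k = t ∧ ∀ x, A k x → C x ≠ t + 1 := by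
        by_contra hcon
        push Not at hcon
        choose! f hfA hfC using hcon
        apply hcap
        have hCi : C i = t + 1 := by omega
        have huniq : ∀ k k' x, C k = t → C k' = t → A k x → A k' x → k = k' := by
          intro k k' x hk hk' h h'
          rcases hcomp k k' x h h' with h | h | h
          · have := hmin k' ⟨k, h, by omega⟩; omega
          · exact h
          · have := hmin k ⟨k', h, by omega⟩; omega
        have hinj : ∀ k k' : Fin n, C k = t → C k' = t → f k = f k' → k = k' := by
          intro k k' hk hk' h
          exact huniq k k' (f k) hk hk' (hfA k hk) (h ▸ hfA k' hk')
        have hnb : ∃ z, C z = t + 1 ∧ ∀ k, C k = t → f k ≠ z := by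
          by_contra hb
          push Not at hb
          obtain ⟨a, ha, hai⟩ := hb i hCi
          obtain ⟨b, hb', hbj⟩ := hb j ht
          have hAa := hfA a ha
          have hAb := hfA b hb'
          rw [hai] at hAa
          rw [hbj] at hAb
          have := huniq a b j ha hb' (htrans _ _ _ hAa hij) hAb
          subst this
          rw [hai] at hbj
          subst hbj
          omega
        obtain ⟨z, hz, hzf⟩ := hnb
        refine lt_of_lt_of_le (b := (Finset.univ.filter fun x => C x = t + 1).card) ?_
          (hC.2.2 (t + 1))
        have h1 : ((Finset.univ.filter fun x => C x = t).image f).card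
            = (Finset.univ.filter fun x => C x = t).card := by
          apply Finset.card_image_of_injOn
          intro a ha b hb h
          simp at ha hb
          exact hinj a b ha hb h
        rw [← h1]
        apply Finset.card_lt_card
        rw [Finset.ssubset_iff_of_subset]
        · refine ⟨z, by simpa using hz, ?_⟩
          simp only [Finset.mem_image, Finset.mem_filter, Finset.mem_univ, true_and]
          rintro ⟨k, hk, hkz⟩
          exact hzf k hk hkz
        · intro x hx
          simp only [Finset.mem_image, Finset.mem_filter, Finset.mem_univ, true_and] at hx ⊢
          obtain ⟨k, hk, rfl⟩ := hx
          exact hfC k hk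
      obtain ⟨h1, h2, h3⟩ := step d A hd hcomp C hC hw i j t hij (by omega) ht hmin hmin'
        (fun x => x = k) (by rintro _ rfl; exact ⟨hk, hkd⟩)
        (fun x => C (Equiv.swap i k x)) (by simp [hk])
        (by rintro _ rfl; simp; omega)
        (fun x hx hx' => by simp only [Equiv.swap_apply_of_ne_of_ne hx hx'])
        (fun s => by rw [card_swap C (Equiv.swap i k) s]; exact hC.2.2 s)
      exact ih _ (by omega) _ h1 h2 rfl
  obtain ⟨C, hC, hw⟩ := exists_weak d A hd hC
  exact key _ C hC hw rfl

lemma chainValue_append_singleton {n : ℕ} (r p : Fin n → ℕ) (l : List (Fin n)) (hl : l ≠ [])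
    (j : Fin n) : chainValue r p (l ++ [j]) = max (r j) (chainValue r p l) + p j := by
  cases l with
  | nil => exact absurd rfl hl
  | cons a l => simp [chainValue]

lemma chainValue_lt_append {n : ℕ} (r : Fin n → ℕ) (l : List (Fin n)) (hl : l ≠ [])
    (s : List (Fin n)) (hs : s ≠ []) :
    chainValue r (fun _ => 1) l < chainValue r (fun _ => 1) (l ++ s) := by
  induction s using List.reverseRecOn with
  | nil => exact absurd rfl hs
  | append_singleton s a ih =>
    rw [← List.append_assoc, chainValue_append_singleton _ _ _ (by simp [hl])]
    by_cases h : s = []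
    · subst h; simp
    · have := ih h
      omega

lemma mc_le {n m : ℕ} (P : Fin n → Finset (Fin n)) (r C : Fin n → ℕ)
    (hC : FeasibleUnit m P r C) (j : Fin n) : mc P r (fun _ => 1) j ≤ C j := by
  have key : ∀ N : ℕ, ∀ j, C j = N →
      ∃ l, IsChainTo P j l ∧ chainValue r (fun _ => 1) l ≤ C j := by
    intro N
    induction N using Nat.strong_induction_on with
    | _ N ih =>
    intro j hj
    have hr := hC.2.2.1 j
    by_cases hP : P j = ∅
    · refine ⟨[j], ⟨by simp, by simp, by simpa using hP, ?_⟩, by simpa [chainValue] using hr⟩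
      exact List.isChain_singleton j
    · obtain ⟨i, hi, hlt⟩ := hC.2.2.2 j hP
      obtain ⟨l, ⟨h1, h2, h3, h4⟩, hv⟩ := ih (C i) (by omega) i rfl
      refine ⟨l ++ [j], ⟨by simp, by simp, ?_, ?_⟩, ?_⟩
      · intro h hh
        rw [List.head?_append_of_ne_nil _ h1] at hh
        exact h3 h hh
      · refine List.IsChain.append h4 (List.isChain_singleton j) ?_
        intro x hx y hy
        rw [h2] at hx
        simp at hx hy
        subst hx; subst hy; exact hi
      · rw [chainValue_append_singleton _ _ _ h1]; omega
  obtain ⟨l, hl, hv⟩ := key _ j rfl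
  exact le_trans (Nat.sInf_le ⟨l, hl, rfl⟩) hv

/-- Existence of an inversion-free optimal schedule for unit processing times:
there is a feasible unit schedule of minimum makespan in which `C i < C j` whenever
`i ≠ j` occurs in the minimal chain `L j`. -/
theorem exists_optimal_without_inversions {n m : ℕ} (hm : 1 ≤ m)
    (P : Fin n → Finset (Fin n)) (r : Fin n → ℕ)
    (hex : ∃ C : Fin n → ℕ, FeasibleUnit m P r C)
    (L : Fin n → List (Fin n)) (hL : ClosedCollection P r L) :
    ∃ C : Fin n → ℕ, FeasibleUnit m P r C ∧
      makespanU C = sInf {v | ∃ C' : Fin n → ℕ, FeasibleUnit m P r C' ∧ makespanU C' = v} ∧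
      ∀ j : Fin n, ∀ i ∈ L j, i ≠ j → C i < C j := by
  obtain ⟨C1, hC1⟩ := hex
  obtain ⟨C0, hC0, hT⟩ := Nat.sInf_mem
    (s := {v | ∃ C' : Fin n → ℕ, FeasibleUnit m P r C' ∧ makespanU C' = v}) ⟨_, C1, hC1, rfl⟩
  set T := sInf {v | ∃ C' : Fin n → ℕ, FeasibleUnit m P r C' ∧ makespanU C' = v} with hTdef
  have hlast : ∀ i j, L i = L j → i = j := by
    intro i j h
    have h1 := (hL i).1.2.1
    have h2 := (hL j).1.2.1
    rw [h, h2] at h1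
    simpa using h1.symm
  have hself : ∀ i, i ∈ L i := fun i => List.mem_of_getLast? (hL i).1.2.1
  have hd : ∀ i j, (i ∈ L j ∧ i ≠ j) → mc P r (fun _ => 1) i < mc P r (fun _ => 1) j := by
    rintro i j ⟨hij, hne⟩
    rw [← (hL i).2.1, ← (hL j).2.1]
    obtain ⟨s, hs⟩ := (hL j).2.2 i hij
    rw [← hs]
    apply chainValue_lt_append _ _ (hL i).1.1
    rintro rfl
    exact hne (hlast i j (by simpa using hs))
  have hstruct : ∀ j, ∃ l, L j = l ++ [j] := by
    intro j
    exact ⟨(L j).dropLast, (List.dropLast_append_getLast? _ (hL j).1.2.1).symm⟩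
  have hmcr : ∀ j, r j + 1 ≤ mc P r (fun _ => 1) j := by
    intro j
    rw [← (hL j).2.1]
    obtain ⟨l, hl⟩ := hstruct j
    rw [hl]
    by_cases h : l = []
    · subst h; simp [chainValue]
    · rw [chainValue_append_singleton _ _ _ h]; omega
  obtain ⟨C, hC, hA⟩ := exists_strict (m := m) (T := T) (mc P r (fun _ => 1))
    (fun i j => i ∈ L j ∧ i ≠ j) (fun j => by have := hmcr j; omega) hd
    (by
      intro i j k h1 h2
      refine ⟨((hL k).2.2 j h2.1).subset h1.1, ?_⟩
      rintro rfl
      have := hd _ _ h1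
      have := hd _ _ h2
      omega)
    (by
      intro i i' j h1 h2
      rcases List.prefix_or_prefix_of_prefix ((hL j).2.2 i h1.1) ((hL j).2.2 i' h2.1) with h | h
      · by_cases hii : i = i'
        · exact Or.inr (Or.inl hii)
        · exact Or.inl ⟨h.subset (hself i), hii⟩
      · by_cases hii : i = i'
        · exact Or.inr (Or.inl hii)
        · exact Or.inr (Or.inr ⟨h.subset (hself i'), fun h => hii h.symm⟩))
    ⟨C0, fun j => mc_le P r C0 hC0 j,
      fun j => by rw [← hT]; exact Finset.le_sup (f := C0) (Finset.mem_univ j), hC0.2.1⟩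
  have hfeas : FeasibleUnit m P r C := by
    have hr : ∀ j, r j + 1 ≤ C j := fun j => le_trans (hmcr j) (hC.1 j)
    refine ⟨fun j => by have := hr j; omega, hC.2.2, hr, ?_⟩
    intro j hP
    obtain ⟨l, hl⟩ := hstruct j
    obtain ⟨⟨h1, h2, h3, h4⟩, h5, -⟩ := hL j
    rw [hl] at h3 h4 h5
    rcases List.eq_nil_or_concat l with h | ⟨l', p, h⟩
    · subst h
      exact absurd (h3 j (by simp)) hP
    · simp only [List.concat_eq_append] at h
      have hlne : l ≠ [] := by simp [h]
      have hch := List.isChain_append.1 h4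
      have hlp : l.getLast? = some p := by simp [h]
      have hpP : p ∈ P j := hch.2.2 p (by simp [hlp]) j (by simp)
      refine ⟨p, hpP, hA p j ⟨by rw [hl]; simp [h], ?_⟩⟩
      rintro rfl
      have hle : mc P r (fun _ => 1) p ≤ chainValue r (fun _ => 1) l := by
        refine Nat.sInf_le ⟨l, ⟨hlne, hlp, ?_, hch.1⟩, rfl⟩
        intro x hx
        exact h3 x (by rw [List.head?_append_of_ne_nil _ hlne]; exact hx)
      have := chainValue_lt_append r l hlne [p] (by simp)
      omega
  refine ⟨C, hfeas, le_antisymm ?_ ?_, fun j i hi hne => hA i j ⟨hi, hne⟩⟩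
  · exact Finset.sup_le fun j _ => hC.2.1 j
  · exact Nat.sInf_le ⟨C, hfeas, rfl⟩
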